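/- Let p be a real homogeneous polynomial of degree d in n variables, S^{n−1} the unit sphere in ℝⁿ with its rotation-invariant probability measure dx, ‖p‖_{2k} = (∫_{S^{n−1}} p(x)^{2k} dx)^{1/(2k)} and ‖p‖_∞ = max_{x∈S^{n−1}} |p(x)|. Then ‖p‖_{2k} ≤ ‖p‖_∞ ≤ C(kd + n − 1, kd)^{1/(2k)} · ‖p‖_{2k} for every positive integer k. -/

import Mathlib

open MeasureTheory

namespace Stmt10

abbrev E (n : ℕ) := EuclideanSpace ℝ (Fin n)

noncomputable def ev {n : ℕ} (f : MvPolynomial (Fin n) ℝ) (x : E n) : ℝ :=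
  MvPolynomial.eval (fun i => x i) f

lemma ev_cont {n : ℕ} (f : MvPolynomial (Fin n) ℝ) : Continuous (ev f) := by
  unfold ev
  exact (MvPolynomial.continuous_eval f).comp (by fun_prop)

lemma ev_add {n : ℕ} (f g : MvPolynomial (Fin n) ℝ) (x : E n) : ev (f + g) x = ev f x + ev g x := by
  simp [ev]

lemma ev_smul {n : ℕ} (c : ℝ) (g : MvPolynomial (Fin n) ℝ) (x : E n) :
    ev (c • g) x = c * ev g x := by
  simp [ev, MvPolynomial.smul_eval]

lemma ev_scale {n m : ℕ} (f : MvPolynomial (Fin n) ℝ) (hf : f.IsHomogeneous m) (c : ℝ) (x : E n) :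
    ev f (c • x) = c ^ m * ev f x := by
  unfold ev
  rw [MvPolynomial.eval_eq, MvPolynomial.eval_eq, Finset.mul_sum]
  refine Finset.sum_congr rfl fun d hd => ?_
  have h1 : ∑ i, d i = m := by
    have := hf (MvPolynomial.mem_support_iff.mp hd)
    rw [← this, Finsupp.weight_apply, Finsupp.sum_fintype] <;> simp
  rw [Finset.prod_subset (Finset.subset_univ d.support), Finset.prod_subset (Finset.subset_univ d.support)]
  · simp only [PiLp.smul_apply, smul_eq_mul, mul_pow, Finset.prod_mul_distrib]
    rw [Finset.prod_pow_eq_pow_sum, h1]; ring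
  all_goals
    intro i _ hi
    simp [Finsupp.notMem_support_iff.mp hi]

lemma integrable_cont {n : ℕ} (μ : Measure (E n)) [IsProbabilityMeasure μ]
    (hsupp : μ (Metric.sphere (0 : E n) 1)ᶜ = 0) (F : E n → ℝ) (hF : Continuous F) :
    Integrable F μ := by
  have h : μ.restrict (Metric.sphere (0 : E n) 1) = μ :=
    Measure.restrict_eq_self_of_ae_mem (by rwa [← compl_mem_ae_iff, compl_compl] at hsupp)
  rw [← h]
  exact hF.continuousOn.integrableOn_compact (isCompact_sphere _ _)

lemma exists_comp {n m : ℕ} (f : MvPolynomial (Fin n) ℝ) (hf : f.IsHomogeneous m)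
    (g : E n ≃ₗᵢ[ℝ] E n) :
    ∃ f' : MvPolynomial (Fin n) ℝ, f'.IsHomogeneous m ∧ ∀ x, ev f' x = ev f (g x) := by
  refine ⟨MvPolynomial.aeval (fun i => ∑ j, MvPolynomial.C ((g (EuclideanSpace.single j 1)) i) *
    MvPolynomial.X j) f, ?_, fun x => ?_⟩
  · have := hf.aeval (τ := Fin n) (S := ℝ) (n := 1) (fun i => ∑ j,
      MvPolynomial.C ((g (EuclideanSpace.single j 1)) i) * MvPolynomial.X j) (fun i => by
        apply MvPolynomial.IsHomogeneous.sum
        intro j _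
        exact MvPolynomial.isHomogeneous_C_mul_X _ _)
    simpa using this
  · have hx : x = ∑ j, x j • (EuclideanSpace.single j (1:ℝ) : E n) := by
      ext i
      simp [Finset.sum_apply, Pi.single_apply]
    have hg : ∀ i, (g x) i = ∑ j, (g (EuclideanSpace.single j 1)) i * x j := by
      intro i
      conv_lhs => rw [hx]
      simp [map_sum, mul_comm]
    unfold ev
    have : (fun i => (g x) i) = fun i => ∑ j, (g (EuclideanSpace.single j 1)) i * x j := funext hg
    rw [this]
    clear hf this
    induction f using MvPolynomial.induction_on with
    | C a => simp
    | add p q hp hq => simp only [map_add, hp, hq]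
    | mul_X p i hp => simp only [map_mul, hp, MvPolynomial.aeval_X, map_sum, MvPolynomial.eval_C,
        MvPolynomial.eval_X]

lemma exists_rot {n : ℕ} (x y : E n) (h : ‖x‖ = ‖y‖) : ∃ g : E n ≃ₗᵢ[ℝ] E n, g x = y :=
  ⟨_, Submodule.reflection_sub h⟩

lemma definite {n m : ℕ} (μ : Measure (E n)) [IsProbabilityMeasure μ]
    (hsupp : μ (Metric.sphere (0 : E n) 1)ᶜ = 0)
    (hinv : ∀ g : E n ≃ₗᵢ[ℝ] E n, Measure.map (⇑g) μ = μ)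
    (f : MvPolynomial (Fin n) ℝ) (hf : f.IsHomogeneous m)
    (h0 : ∫ x, ev f x * ev f x ∂μ = 0) : f = 0 := by
  have hU : μ {x | ev f x ≠ 0} = 0 := by
    rw [integral_eq_zero_iff_of_nonneg (fun x => mul_self_nonneg _)
      (integrable_cont μ hsupp _ ((ev_cont f).mul (ev_cont f)))] at h0
    have : ∀ᵐ x ∂μ, ev f x = 0 := by
      filter_upwards [h0] with x hx
      simpa using hx
    exact this
  have hopen : IsOpen {x | ev f x ≠ 0} := isOpen_ne_fun (ev_cont f) continuous_const
  have hsph : ∀ y ∈ Metric.sphere (0 : E n) 1, ev f y = 0 := by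
    intro y hy
    by_contra hne
    have : μ (Metric.sphere (0 : E n) 1) = 0 := by
      refine measure_null_of_locally_null _ fun x hx => ?_
      obtain ⟨g, hg⟩ := exists_rot x y (by simp at hx hy; rw [hx, hy])
      refine ⟨g ⁻¹' {x | ev f x ≠ 0}, mem_nhdsWithin_of_mem_nhds
        ((hopen.preimage g.continuous).mem_nhds (by simpa [hg] using hne)), ?_⟩
      rw [← Measure.map_apply g.continuous.measurable hopen.measurableSet, hinv, hU]
    have h2 : μ Set.univ = 0 := by
      rw [← Set.union_compl_self (Metric.sphere (0 : E n) 1)]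
      exact measure_union_null this hsupp
    simp at h2
  have hoff : ∀ y : E n, y ≠ 0 → ev f y = 0 := by
    intro y hy
    have := ev_scale f hf ‖y‖ (‖y‖⁻¹ • y)
    rw [smul_smul, mul_inv_cancel₀ (norm_ne_zero_iff.mpr hy), one_smul] at this
    rw [this, hsph _ (by simp [norm_smul, norm_ne_zero_iff.mpr hy]), mul_zero]
  have hcl : IsClosed {y : E n | ev f y = 0} := isClosed_eq (ev_cont f) continuous_const
  have hn : Nontrivial (E n) := by
    by_contra hnt
    rw [not_nontrivial_iff_subsingleton] at hnt
    have : (Metric.sphere (0 : E n) 1)ᶜ = Set.univ := by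
      ext x; simp [Subsingleton.elim x 0]
    rw [this] at hsupp
    simp at hsupp
  have hall : ∀ y : E n, ev f y = 0 := by
    intro y
    have hd : Dense ({0}ᶜ : Set (E n)) := dense_compl_singleton 0
    have : closure ({0}ᶜ : Set (E n)) ⊆ {y : E n | ev f y = 0} :=
      hcl.closure_subset_iff.mpr fun z hz => hoff z hz
    exact this (hd y)
  apply MvPolynomial.funext
  intro v
  have := hall (WithLp.toLp 2 v)
  simpa [ev] using this

lemma finrank_hom (n m : ℕ) :
    Module.Finite ℝ (MvPolynomial.homogeneousSubmodule (Fin n) ℝ m) ∧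
    Module.finrank ℝ (MvPolynomial.homogeneousSubmodule (Fin n) ℝ m) = (m + n - 1).choose m := by
  have hS : {d : Fin n →₀ ℕ | d.degree = m} = (((Finset.univ : Finset (Fin n)).finsuppAntidiag m : Finset (Fin n →₀ ℕ)) : Set (Fin n →₀ ℕ)) := by
    ext d
    simp [Finsupp.degree_eq_sum]
  rw [MvPolynomial.homogeneousSubmodule_eq_finsupp_supported, hS]
  let e := AddMonoidAlgebra.supportedEquivFinsupp (R := ℝ) (S := ℝ) (((Finset.univ : Finset (Fin n)).finsuppAntidiag m : Finset (Fin n →₀ ℕ)) : Set (Fin n →₀ ℕ))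
  constructor
  · exact Module.Finite.equiv e.symm
  · refine e.finrank_eq.trans ?_
    rw [Module.finrank_finsupp_self]
    simp [Finset.card_finsuppAntidiag_nat_eq_choose, add_comm]

lemma exists_onb {V : Type*} [AddCommGroup V] [Module ℝ V] [Module.Finite ℝ V]
    (c : InnerProductSpace.Core ℝ V) :
    ∃ b : Module.Basis (Fin (Module.finrank ℝ V)) ℝ V, ∀ i j, c.inner (b i) (b j) = if i = j then 1 else 0 := by
  let _ : NormedAddCommGroup V := c.toNormedAddCommGroup
  let _ : InnerProductSpace ℝ V := InnerProductSpace.ofCore c.toCore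
  let b := stdOrthonormalBasis ℝ V
  refine ⟨b.toBasis, fun i j => ?_⟩
  have := orthonormal_iff_ite.mp b.orthonormal i j
  simpa using this

@[reducible] noncomputable def core {n : ℕ} (m : ℕ) (μ : Measure (E n)) [IsProbabilityMeasure μ]
    (hsupp : μ (Metric.sphere (0 : E n) 1)ᶜ = 0)
    (hinv : ∀ g : E n ≃ₗᵢ[ℝ] E n, Measure.map (⇑g) μ = μ) :
    InnerProductSpace.Core ℝ (MvPolynomial.homogeneousSubmodule (Fin n) ℝ m) where
  inner f g := ∫ x, ev f.1 x * ev g.1 x ∂μ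
  conj_inner_symm f g := by simp [mul_comm]
  re_inner_nonneg f := by
    simp only [RCLike.re_to_real]
    exact integral_nonneg fun x => mul_self_nonneg _
  add_left f g h := by
    simp only [Submodule.coe_add, ev_add, add_mul]
    exact integral_add (integrable_cont μ hsupp _ ((ev_cont _).mul (ev_cont _)))
      (integrable_cont μ hsupp _ ((ev_cont _).mul (ev_cont _)))
  smul_left f g r := by
    simp only [Submodule.coe_smul, ev_smul, mul_assoc]
    rw [integral_const_mul]; rfl
  definite f h := Subtype.ext (definite μ hsupp hinv f.1 f.2 h)

lemma key {n m : ℕ} (μ : Measure (E n)) [IsProbabilityMeasure μ]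
    (hsupp : μ (Metric.sphere (0 : E n) 1)ᶜ = 0)
    (hinv : ∀ g : E n ≃ₗᵢ[ℝ] E n, Measure.map (⇑g) μ = μ)
    (f : MvPolynomial (Fin n) ℝ) (hf : f.IsHomogeneous m) (x : E n)
    (hx : x ∈ Metric.sphere (0 : E n) 1) :
    ev f x ^ 2 ≤ ((m + n - 1).choose m : ℝ) * ∫ y, ev f y ^ 2 ∂μ := by
  obtain ⟨hfin, hrank⟩ := finrank_hom n m
  obtain ⟨b, hb⟩ := exists_onb (core m μ hsupp hinv)
  have hb' : ∀ i j, ∫ x, ev (b i).1 x * ev (b j).1 x ∂μ = if i = j then 1 else 0 := hb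
  have hI : ∀ F : E n → ℝ, Continuous F → Integrable F μ := integrable_cont μ hsupp
  set K : E n → ℝ := fun x => ∑ i, ev (b i).1 x ^ 2 with hK
  have evsum : ∀ (c : Fin (Module.finrank ℝ (MvPolynomial.homogeneousSubmodule (Fin n) ℝ m)) → ℝ) x,
      ev (∑ i, c i • b i).1 x = ∑ i, c i * ev (b i).1 x := by
    intro c x
    simp [ev, MvPolynomial.smul_eval]
  have nrm : ∀ (c : Fin (Module.finrank ℝ (MvPolynomial.homogeneousSubmodule (Fin n) ℝ m)) → ℝ),
      ∫ x, ev (∑ i, c i • b i).1 x ^ 2 ∂μ = ∑ i, c i ^ 2 := by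
    intro c
    have : ∀ x, ev (∑ i, c i • b i).1 x ^ 2 =
        ∑ i, ∑ j, (c i * c j) * (ev (b i).1 x * ev (b j).1 x) := by
      intro x
      rw [evsum, sq, Finset.sum_mul_sum]
      refine Finset.sum_congr rfl fun i _ => Finset.sum_congr rfl fun j _ => by ring
    simp_rw [this]
    have hc := fun i => ev_cont (b i).1
    rw [integral_finsetSum _ fun i _ => hI _ (by fun_prop)]
    refine Finset.sum_congr rfl fun i _ => ?_
    rw [integral_finsetSum _ fun j _ => hI _ (by fun_prop)]
    simp_rw [integral_const_mul, hb']
    simp [sq]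
  have cs : ∀ h : MvPolynomial (Fin n) ℝ, h.IsHomogeneous m → ∀ x,
      ev h x ^ 2 ≤ (∫ y, ev h y ^ 2 ∂μ) * K x := by
    intro h hh x
    have e := b.sum_repr ⟨h, hh⟩
    have e1 := evsum (b.repr ⟨h, hh⟩) x
    have e2 := nrm (b.repr ⟨h, hh⟩)
    rw [e] at e1 e2
    simp only at e1 e2
    rw [e1, e2]
    exact Finset.sum_mul_sq_le_sq_mul_sq _ _ _
  have hKnn : ∀ x, 0 ≤ K x := fun x => Finset.sum_nonneg fun i _ => sq_nonneg _
  have hmono : ∀ x y, ‖x‖ = ‖y‖ → K y ≤ K x := by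
    intro x y hxy
    obtain ⟨g, hg⟩ := exists_rot x y hxy
    set q := ∑ i, ev (b i).1 y • b i with hq
    obtain ⟨q', hq', hqe⟩ := exists_comp q.1 q.2 g
    have h1 := cs q' hq' x
    have h2 : ev q' x = K y := by
      rw [hqe, hg, hq, evsum]; simp [hK, sq]
    have h3 : ∫ z, ev q' z ^ 2 ∂μ = K y := by
      simp_rw [hqe]
      have h4 := nrm fun i => ev (b i).1 y
      change _ = ∑ i, ev (b i).1 y ^ 2
      rw [← h4, ← hq]
      conv_rhs => rw [← hinv g]
      rw [integral_map g.continuous.measurable.aemeasurable]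
      exact ((ev_cont _).pow 2).aestronglyMeasurable
    rw [h2, h3] at h1
    rcases (hKnn y).eq_or_lt with h | h
    · rw [← h]; exact hKnn x
    · nlinarith
  have hKint : ∫ y, K y ∂μ = ((m + n - 1).choose m : ℝ) := by
    simp only [hK]
    have hc := fun i => ev_cont (b i).1
    rw [integral_finsetSum _ fun i _ => hI _ (by fun_prop)]
    have : ∀ i, ∫ y, ev (b i).1 y ^ 2 ∂μ = 1 := by
      intro i; simpa [sq] using hb' i i
    simp [this, hrank]
  have hKx : K x ≤ ((m + n - 1).choose m : ℝ) := by
    rw [← hKint]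
    have : ∫ y, K x ∂μ ≤ ∫ y, K y ∂μ := by
      refine integral_mono_ae (integrable_const _)
        (hI _ (continuous_finsetSum _ fun i _ => (ev_cont _).pow 2)) ?_
      have hae : ∀ᵐ y ∂μ, y ∈ Metric.sphere (0 : E n) 1 := hsupp
      filter_upwards [hae] with y hy
      exact hmono y x (by simp at hx hy; rw [hx, hy])
    simpa using this
  rw [mul_comm]
  exact (cs f hf x).trans (mul_le_mul_of_nonneg_left hKx (integral_nonneg fun y => sq_nonneg _))

end Stmt10


/-- Corollary 3.1: for a homogeneous polynomial `p` of degree `d` in `n`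
variables and the rotation-invariant probability measure on the unit sphere,
`‖p‖_{2k} ≤ ‖p‖_∞ ≤ C(kd+n-1, kd)^{1/(2k)} ‖p‖_{2k}`. -/
theorem stmt_10
    (n d k : ℕ) (hk : 0 < k)
    (p : MvPolynomial (Fin n) ℝ) (hp : p.IsHomogeneous d)
    (μ : Measure (EuclideanSpace ℝ (Fin n))) [IsProbabilityMeasure μ]
    (hsupp : μ (Metric.sphere (0 : EuclideanSpace ℝ (Fin n)) 1)ᶜ = 0)
    (hinv : ∀ g : EuclideanSpace ℝ (Fin n) ≃ₗᵢ[ℝ] EuclideanSpace ℝ (Fin n),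
      Measure.map (⇑g) μ = μ) :
    (∫ x, (MvPolynomial.eval (fun i => x i) p) ^ (2 * k) ∂μ) ^ ((1 : ℝ) / (2 * k))
        ≤ (⨆ x : Metric.sphere (0 : EuclideanSpace ℝ (Fin n)) 1,
            |MvPolynomial.eval (fun i => (x : EuclideanSpace ℝ (Fin n)) i) p|) ∧
    (⨆ x : Metric.sphere (0 : EuclideanSpace ℝ (Fin n)) 1,
        |MvPolynomial.eval (fun i => (x : EuclideanSpace ℝ (Fin n)) i) p|)
      ≤ ((k * d + n - 1).choose (k * d) : ℝ) ^ ((1 : ℝ) / (2 * k))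
        * (∫ x, (MvPolynomial.eval (fun i => x i) p) ^ (2 * k) ∂μ) ^ ((1 : ℝ) / (2 * k)) := by
  have hrw : ∀ x : EuclideanSpace ℝ (Fin n), MvPolynomial.eval (fun i => x i) p = Stmt10.ev p x :=
    fun x => rfl
  simp only [hrw]
  have hae : ∀ᵐ y ∂μ, y ∈ Metric.sphere (0 : Stmt10.E n) 1 := hsupp
  have hk2 : (0:ℝ) < 2 * k := by positivity
  have hInn : 0 ≤ ∫ x, (Stmt10.ev p x) ^ (2 * k) ∂μ :=
    integral_nonneg fun x => by
      rw [pow_mul]; exact pow_nonneg (sq_nonneg _) _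
  have hbdd : BddAbove (Set.range fun x : Metric.sphere (0 : Stmt10.E n) 1 => |Stmt10.ev p x|) := by
    have := (isCompact_sphere (0 : Stmt10.E n) 1).bddAbove_image (f := fun x => |Stmt10.ev p x|)
      (Stmt10.ev_cont p).abs.continuousOn
    rwa [Set.image_eq_range] at this
  have hroot : ∀ a : ℝ, 0 ≤ a → (a ^ (2 * k)) ^ ((1:ℝ) / (2 * k)) = a := by
    intro a ha
    rw [← Real.rpow_natCast, ← Real.rpow_mul ha]
    push_cast
    rw [mul_one_div_cancel hk2.ne', Real.rpow_one]
  have hMnn : 0 ≤ ⨆ x : Metric.sphere (0 : Stmt10.E n) 1, |Stmt10.ev p x| :=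
    Real.iSup_nonneg fun x => abs_nonneg _
  constructor
  · set M := ⨆ x : Metric.sphere (0 : Stmt10.E n) 1, |Stmt10.ev p x| with hM
    rw [← hroot M hMnn]
    refine Real.rpow_le_rpow hInn ?_ (by positivity)
    have : ∫ x, (Stmt10.ev p x) ^ (2 * k) ∂μ ≤ ∫ x, M ^ (2 * k) ∂μ := by
      refine integral_mono_ae (Stmt10.integrable_cont μ hsupp _ ((Stmt10.ev_cont p).pow _))
        (integrable_const _) ?_
      filter_upwards [hae] with y hy
      have h1 : |Stmt10.ev p y| ≤ M := le_ciSup hbdd ⟨y, hy⟩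
      have h2 := pow_le_pow_left₀ (abs_nonneg _) h1 (2 * k)
      rwa [Even.pow_abs (even_two_mul k)] at h2
    simpa using this
  · refine Real.iSup_le (fun x => ?_) (by positivity)
    rw [← Real.mul_rpow (by positivity) hInn, ← hroot _ (abs_nonneg (Stmt10.ev p x))]
    refine Real.rpow_le_rpow (by positivity) ?_ (by positivity)
    rw [Even.pow_abs (even_two_mul k)]
    have hh : (p ^ k).IsHomogeneous (k * d) := by
      rw [mul_comm]; exact hp.pow k
    have := Stmt10.key μ hsupp hinv (p ^ k) hh x.1 x.2
    have he : ∀ y, Stmt10.ev (p ^ k) y ^ 2 = Stmt10.ev p y ^ (2 * k) := by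
      intro y
      simp [Stmt10.ev, ← pow_mul, mul_comm]
    simpa only [he] using this
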